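/- Let X and Y be finite-dimensional Banach spaces with Y strictly convex. Then Π₂(X, Y) is strictly convex if and only if for every subspace E ⊆ X and every linear operator t : E → Y there exists a unique linear extension T : X → Y with π₂(T) = π₂(t). -/

import Mathlib

open scoped BigOperators

/-- The 2-summing norm of a continuous linear operator between real normed spaces. -/
noncomputable def pi2 {X Y : Type*} [NormedAddCommGroup X] [NormedSpace ℝ X]
    [NormedAddCommGroup Y] [NormedSpace ℝ Y] (T : X →L[ℝ] Y) : ℝ :=
  sSup { r : ℝ | ∃ (m : ℕ) (x : Fin m → X),
    (∀ f : X →L[ℝ] ℝ, ∑ i, (f (x i)) ^ 2 ≤ ‖f‖ ^ 2) ∧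
    r = Real.sqrt (∑ i, ‖T (x i)‖ ^ 2) }


open Finset in
/-- In finite dimension, the convex hull of a compact set is compact. -/
theorem isCompact_convexHull_fd {V : Type*} [NormedAddCommGroup V] [NormedSpace ℝ V]
    [FiniteDimensional ℝ V] {s : Set V} (hs : IsCompact s) : IsCompact (convexHull ℝ s) := by
  classical
  rcases s.eq_empty_or_nonempty with rfl | ⟨a, ha⟩
  · simp
  set d := Module.finrank ℝ V + 1
  have hK : IsCompact ((stdSimplex ℝ (Fin d)) ×ˢ (Set.univ.pi fun _ : Fin d => s)) :=
    (isCompact_stdSimplex ℝ _).prod (isCompact_univ_pi fun _ => hs)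
  have hc : Continuous (fun p : (Fin d → ℝ) × (Fin d → V) => ∑ i, p.1 i • p.2 i) := by fun_prop
  convert hK.image hc using 1
  ext x
  constructor
  · intro hx
    obtain ⟨ι, _, z, w, hz, haff, hw, hw1, hx⟩ := eq_pos_convex_span_of_mem_convexHull hx
    have hcard : Fintype.card ι ≤ Fintype.card (Fin d) := by
      simpa [d] using haff.card_le_finrank_succ.trans
        (Nat.succ_le_succ (Submodule.finrank_le _))
    obtain ⟨e⟩ := Function.Embedding.nonempty_of_card_le hcard
    have key : ∀ {W : Type _} [AddCommGroup W] [Module ℝ W] (g : ι → W) (G : Fin d → W),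
        (∀ i, G (e i) = g i) → (∀ j, j ∉ Set.range e → G j = 0) → ∑ j, G j = ∑ i, g i := by
      intro W _ _ g G h1 h2
      rw [← Fintype.sum_of_injective e e.injective g G h2 (fun i => (h1 i).symm)]
    have key' : ∀ (g : ι → ℝ) (G : Fin d → ℝ),
        (∀ i, G (e i) = g i) → (∀ j, j ∉ Set.range e → G j = 0) → ∑ j, G j = ∑ i, g i := by
      intro g G h1 h2
      rw [← Fintype.sum_of_injective e e.injective g G h2 (fun i => (h1 i).symm)]
    refine ⟨(Function.extend e w 0, Function.extend e z fun _ => a), ⟨⟨?_, ?_⟩, ?_⟩, ?_⟩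
    · intro j
      by_cases hj : ∃ i, e i = j
      · obtain ⟨i, rfl⟩ := hj
        simpa [e.injective.extend_apply] using (hw i).le
      · simp [Function.extend_apply' _ _ _ hj]
    · rw [← hw1]
      refine key' _ _ (fun i => e.injective.extend_apply _ _ _) ?_
      intro j hj
      simp [Function.extend_apply' _ _ _ hj]
    · intro j _
      by_cases hj : ∃ i, e i = j
      · obtain ⟨i, rfl⟩ := hj
        simpa [e.injective.extend_apply] using hz ⟨i, rfl⟩
      · simpa [Function.extend_apply' _ _ _ hj] using ha
    · rw [← hx]
      refine key _ _ (fun i => ?_) ?_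
      · simp [e.injective.extend_apply]
      · intro j hj
        simp [Function.extend_apply' _ _ _ hj]
  · rintro ⟨⟨w, z⟩, ⟨⟨hw, hw1⟩, hz⟩, rfl⟩
    exact mem_convexHull_of_exists_fintype w z hw hw1 (fun i => hz i trivial) rfl

section
variable {X Y : Type*} [NormedAddCommGroup X] [NormedSpace ℝ X] [FiniteDimensional ℝ X]
    [NormedAddCommGroup Y] [NormedSpace ℝ Y]

/-- Uniform bound for weakly 2-summable families. -/
theorem weak_bound (X : Type*) [NormedAddCommGroup X] [NormedSpace ℝ X] [FiniteDimensional ℝ X] :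
    ∃ M : ℝ, 0 ≤ M ∧ ∀ (m : ℕ) (x : Fin m → X),
    (∀ f : X →L[ℝ] ℝ, ∑ i, (f (x i)) ^ 2 ≤ ‖f‖ ^ 2) → ∑ i, ‖x i‖ ^ 2 ≤ M := by
  set b := Module.finBasis ℝ X
  let c : Fin (Module.finrank ℝ X) → (X →L[ℝ] ℝ) := fun j => LinearMap.toContinuousLinearMap (b.coord j)
  refine ⟨(∑ j, ‖b j‖ ^ 2) * ∑ j, ‖c j‖ ^ 2, by positivity, fun m x hx => ?_⟩
  have h1 : ∀ v : X, ‖v‖ ^ 2 ≤ (∑ j, ‖b j‖ ^ 2) * ∑ j, (c j v) ^ 2 := by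
    intro v
    have : ‖v‖ ≤ ∑ j, ‖b j‖ * |c j v| := by
      conv_lhs => rw [← b.sum_repr v]
      refine (norm_sum_le _ _).trans (Finset.sum_le_sum fun j _ => ?_)
      rw [norm_smul, mul_comm]; rfl
    calc ‖v‖ ^ 2 ≤ (∑ j, ‖b j‖ * |c j v|) ^ 2 := by gcongr
      _ ≤ (∑ j, ‖b j‖ ^ 2) * ∑ j, |c j v| ^ 2 := Finset.sum_mul_sq_le_sq_mul_sq _ _ _
      _ = _ := by simp
  calc ∑ i, ‖x i‖ ^ 2 ≤ ∑ i, (∑ j, ‖b j‖ ^ 2) * ∑ j, (c j (x i)) ^ 2 :=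
        Finset.sum_le_sum fun i _ => h1 _
    _ = (∑ j, ‖b j‖ ^ 2) * ∑ j, ∑ i, (c j (x i)) ^ 2 := by
        rw [← Finset.mul_sum, Finset.sum_comm]
    _ ≤ _ := by
        gcongr with j
        exact hx _

theorem pi2_bddAbove (T : X →L[ℝ] Y) : BddAbove { r : ℝ | ∃ (m : ℕ) (x : Fin m → X),
    (∀ f : X →L[ℝ] ℝ, ∑ i, (f (x i)) ^ 2 ≤ ‖f‖ ^ 2) ∧
    r = Real.sqrt (∑ i, ‖T (x i)‖ ^ 2) } := by
  obtain ⟨M, hM, h⟩ := weak_bound X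
  refine ⟨Real.sqrt (‖T‖ ^ 2 * M), ?_⟩
  rintro r ⟨m, x, hx, rfl⟩
  apply Real.sqrt_le_sqrt
  calc ∑ i, ‖T (x i)‖ ^ 2 ≤ ∑ i, ‖T‖ ^ 2 * ‖x i‖ ^ 2 := by
        refine Finset.sum_le_sum fun i _ => ?_
        rw [← mul_pow]
        gcongr
        exact T.le_opNorm _
    _ ≤ _ := by
        rw [← Finset.mul_sum]
        gcongr
        exact h m x hx

theorem pi2_nonneg (T : X →L[ℝ] Y) : 0 ≤ pi2 T := by
  apply Real.sSup_nonneg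
  rintro r ⟨m, x, hx, rfl⟩
  positivity

theorem pi2_bound_fin (T : X →L[ℝ] Y) {m : ℕ} (x : Fin m → X)
    (hx : ∀ f : X →L[ℝ] ℝ, ∑ i, (f (x i)) ^ 2 ≤ ‖f‖ ^ 2) :
    ∑ i, ‖T (x i)‖ ^ 2 ≤ pi2 T ^ 2 := by
  have : Real.sqrt (∑ i, ‖T (x i)‖ ^ 2) ≤ pi2 T := le_csSup (pi2_bddAbove T) ⟨m, x, hx, rfl⟩
  rwa [Real.sqrt_le_left (pi2_nonneg T)] at this

theorem pi2_le (T : X →L[ℝ] Y) {C : ℝ} (hC : 0 ≤ C)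
    (h : ∀ (m : ℕ) (x : Fin m → X), (∀ f : X →L[ℝ] ℝ, ∑ i, (f (x i)) ^ 2 ≤ ‖f‖ ^ 2) →
      ∑ i, ‖T (x i)‖ ^ 2 ≤ C ^ 2) : pi2 T ≤ C := by
  refine csSup_le ⟨_, 0, Fin.elim0, by simp, rfl⟩ ?_
  rintro r ⟨m, x, hx, rfl⟩
  rw [Real.sqrt_le_left hC]
  exact h m x hx

theorem pi2_bound (T : X →L[ℝ] Y) {ι : Type*} [Fintype ι] (x : ι → X) {s : ℝ} (hs : 0 ≤ s)
    (hx : ∀ f : X →L[ℝ] ℝ, ∑ i, (f (x i)) ^ 2 ≤ s * ‖f‖ ^ 2) :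
    ∑ i, ‖T (x i)‖ ^ 2 ≤ s * pi2 T ^ 2 := by
  rcases hs.eq_or_lt with rfl | hs
  · have : ∀ i, x i = 0 := by
      intro i
      by_contra hne
      obtain ⟨g, hg, hgx⟩ := exists_dual_vector ℝ (x i) (norm_ne_zero_iff.mpr hne)
      have h1 := hx g
      have h2 := Finset.single_le_sum (f := fun i => (g (x i)) ^ 2) (fun i _ => sq_nonneg _)
        (Finset.mem_univ i)
      simp only [hgx] at h2
      have h3 : 0 < ‖x i‖ ^ 2 := by positivity
      simp at h2
      linarith
    simp [this]
  · have h := pi2_bound_fin T (fun i => (Real.sqrt s)⁻¹ • x ((Fintype.equivFin ι).symm i)) ?_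
    · rw [Equiv.sum_comp (Fintype.equivFin ι).symm (fun i => ‖T ((Real.sqrt s)⁻¹ • x i)‖ ^ 2)] at h
      simp only [map_smul, norm_smul, mul_pow, ← Finset.mul_sum] at h
      rw [norm_inv, inv_pow, Real.norm_eq_abs, sq_abs, Real.sq_sqrt hs.le, inv_mul_le_iff₀ hs] at h
      exact h
    · intro f
      rw [Equiv.sum_comp (Fintype.equivFin ι).symm (fun i => (f ((Real.sqrt s)⁻¹ • x i)) ^ 2)]
      simp only [map_smul, smul_eq_mul, mul_pow, ← Finset.mul_sum]
      rw [inv_pow, Real.sq_sqrt hs.le, inv_mul_le_iff₀ hs]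
      exact hx f

/-- Restriction does not increase the 2-summing norm. -/
theorem pi2_restrict_le (E : Submodule ℝ X) (T : X →L[ℝ] Y) (t : E →L[ℝ] Y)
    (h : ∀ v : E, T v = t v) : pi2 t ≤ pi2 T := by
  refine pi2_le t (pi2_nonneg T) fun m x hx => ?_
  simp only [← h]
  refine pi2_bound_fin T (fun i => (x i : X)) fun f => ?_
  refine (hx (f.comp E.subtypeL)).trans ?_
  gcongr
  refine (ContinuousLinearMap.opNorm_comp_le _ _).trans ?_
  exact mul_le_of_le_one_right (norm_nonneg _) (Submodule.norm_subtypeL_le E)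

end

/-- The evaluation of a matrix on a vector, as a linear functional in the matrix. -/
noncomputable def qf {ι : Type*} [Fintype ι] (c : ι → ℝ) : (ι × ι → ℝ) →L[ℝ] ℝ :=
  ∑ p : ι × ι, (c p.1 * c p.2) • ContinuousLinearMap.proj p

theorem qf_tens {ι : Type*} [Fintype ι] (c a : ι → ℝ) :
    qf c (fun p => a p.1 * a p.2) = (∑ i, c i * a i) ^ 2 := by
  simp only [qf, sum_apply, smul_apply,
    ContinuousLinearMap.proj_apply, smul_eq_mul]
  rw [sq, Finset.sum_mul_sum, Fintype.sum_prod_type]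
  refine Finset.sum_congr rfl fun i _ => Finset.sum_congr rfl fun j _ => by ring


/-- Values of functionals in a basis. -/
theorem qf_eval {X : Type*} [NormedAddCommGroup X] [NormedSpace ℝ X]
    {ι : Type*} [Fintype ι] (b : Module.Basis ι ℝ X) (f : X →L[ℝ] ℝ) (x : X) :
    ∑ i, f (b i) * b.repr x i = f x := by
  have h := congrArg f (b.sum_repr x)
  rw [map_sum] at h
  rw [← h]
  refine Finset.sum_congr rfl fun i _ => ?_
  rw [map_smul, smul_eq_mul, mul_comm]

/-- The supremum defining the 2-summing norm is attained. -/
theorem pi2_attained {X Y : Type*} [NormedAddCommGroup X] [NormedSpace ℝ X]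
    [FiniteDimensional ℝ X] [NormedAddCommGroup Y] [NormedSpace ℝ Y] (T : X →L[ℝ] Y) :
    ∃ (ι : Type) (_ : Fintype ι) (x : ι → X),
      (∀ f : X →L[ℝ] ℝ, ∑ i, (f (x i)) ^ 2 ≤ ‖f‖ ^ 2) ∧ ∑ i, ‖T (x i)‖ ^ 2 = pi2 T ^ 2 := by
  obtain ⟨M0, hM0, hM⟩ := weak_bound X
  set M := M0 + 1
  have hMpos : 0 < M := by positivity
  set b := Module.finBasis ℝ X
  let n := Fin (Module.finrank ℝ X)
  let Φ : X → (n × n → ℝ) × ℝ :=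
    fun x => (fun p => b.repr x p.1 * b.repr x p.2, ‖T x‖ ^ 2)
  have hΦs : ∀ (a : ℝ) (x : X), Φ (a • x) = (a ^ 2) • Φ x := by
    intro a x
    ext
    · simp [Φ]; ring
    · simp [Φ, norm_smul, mul_pow]
  have hΦ0 : Φ 0 = 0 := by simpa using hΦs 0 0
  have hΦc : Continuous Φ := by
    have hr : ∀ i, Continuous fun x : X => b.repr x i := fun i =>
      (LinearMap.toContinuousLinearMap (b.coord i)).continuous
    refine Continuous.prodMk ?_ (by fun_prop)
    exact continuous_pi fun p => (hr _).mul (hr _)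
  have hΦq : ∀ (f : X →L[ℝ] ℝ) (x : X), qf (fun i => f (b i)) (Φ x).1 = (f x) ^ 2 := by
    intro f x
    rw [← qf_eval b f x]
    exact qf_tens _ _
  let C := convexHull ℝ (Φ '' Metric.closedBall 0 1)
  have hC : IsCompact C :=
    isCompact_convexHull_fd ((isCompact_closedBall (0 : X) 1).image hΦc)
  let F : Set ((n × n → ℝ) × ℝ) :=
    {p | ∀ f : X →L[ℝ] ℝ, M * qf (fun i => f (b i)) p.1 ≤ ‖f‖ ^ 2}
  have hF : IsClosed F := by
    have : F = ⋂ f : X →L[ℝ] ℝ, {p | M * qf (fun i => f (b i)) p.1 ≤ ‖f‖ ^ 2} := by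
      ext; simp [F]
    rw [this]
    refine isClosed_iInter fun f => isClosed_le ?_ continuous_const
    fun_prop
  have h0 : (0 : (n × n → ℝ) × ℝ) ∈ C ∩ F := by
    refine ⟨subset_convexHull _ _ ⟨0, by simp, hΦ0⟩, fun f => ?_⟩
    simp
  obtain ⟨p, ⟨hpC, hpF⟩, hmax⟩ := (hC.inter_right hF).exists_isMaxOn ⟨0, h0⟩
    (continuous_snd.continuousOn)
  obtain ⟨ι, _, w, z, hw, hw1, hz, hp⟩ := mem_convexHull_iff_exists_fintype.1 hpC
  choose y hy hyz using hz
  have hsq : ∀ i, Real.sqrt (M * w i) ^ 2 = M * w i := fun i =>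
    Real.sq_sqrt (mul_nonneg hMpos.le (hw i))
  have hweak : ∀ f : X →L[ℝ] ℝ, ∑ i, (f (Real.sqrt (M * w i) • y i)) ^ 2 ≤ ‖f‖ ^ 2 := by
    intro f
    refine le_trans (le_of_eq ?_) (hpF f)
    rw [← hp, Prod.fst_sum, map_sum, Finset.mul_sum]
    refine Finset.sum_congr rfl fun i _ => ?_
    rw [Prod.smul_fst, map_smul, map_smul, ← hyz, hΦq, smul_eq_mul, smul_eq_mul, mul_pow, hsq]
    ring
  have hval : ∑ i, ‖T (Real.sqrt (M * w i) • y i)‖ ^ 2 = M * p.2 := by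
    rw [← hp, Prod.snd_sum, Finset.mul_sum]
    refine Finset.sum_congr rfl fun i _ => ?_
    rw [Prod.smul_snd, ← hyz, map_smul, norm_smul, mul_pow, Real.norm_eq_abs, sq_abs, hsq]
    simp [Φ]; ring
  refine ⟨ι, inferInstance, fun i => Real.sqrt (M * w i) • y i, hweak, ?_⟩
  apply le_antisymm
  · simpa using pi2_bound T (s := 1) (fun i => Real.sqrt (M * w i) • y i) zero_le_one
      (by simpa using hweak)
  · have hMp : 0 ≤ M * p.2 := by rw [← hval]; positivity
    have : pi2 T ≤ Real.sqrt (M * p.2) := by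
      refine pi2_le T (Real.sqrt_nonneg _) fun m x hx => ?_
      rw [Real.sq_sqrt hMp]
      have hq : (M⁻¹ • ∑ i, Φ (x i)) ∈ C ∩ F := by
        constructor
        · have hle : (∑ i, ‖x i‖ ^ 2) / M ≤ 1 := by
            rw [div_le_one hMpos]
            exact (hM m x hx).trans (by simp [M])
          refine mem_convexHull_of_exists_fintype (ι := Option (Fin m))
            (fun o => o.elim (1 - (∑ i, ‖x i‖ ^ 2) / M) fun i => ‖x i‖ ^ 2 / M)
            (fun o => o.elim (Φ 0) fun i => Φ (‖x i‖⁻¹ • x i)) ?_ ?_ ?_ ?_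
          · rintro (_ | i)
            · simpa using hle
            · simp only [Option.elim]; positivity
          · rw [Fintype.sum_option]
            simp [← Finset.sum_div]
          · rintro (_ | i)
            · exact ⟨0, by simp, rfl⟩
            · refine ⟨_, ?_, rfl⟩
              simp only [mem_closedBall_zero_iff, norm_smul, norm_inv, norm_norm]
              exact inv_mul_le_one
          · rw [Fintype.sum_option]
            simp only [Option.elim, hΦ0, smul_zero, zero_add, Finset.smul_sum]
            refine Finset.sum_congr rfl fun i _ => ?_
            rw [hΦs, smul_smul]
            by_cases hxi : x i = 0
            · simp [hxi, hΦ0]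
            · congr 1
              have := norm_ne_zero_iff.mpr hxi
              field_simp
        · intro f
          rw [Prod.smul_fst, map_smul, smul_eq_mul, mul_inv_cancel_left₀ hMpos.ne', Prod.fst_sum,
            map_sum]
          simpa only [hΦq] using hx f
      have h1 : (M⁻¹ • ∑ i, Φ (x i)).2 ≤ p.2 := hmax hq
      rw [Prod.smul_snd, Prod.snd_sum, smul_eq_mul, inv_mul_le_iff₀ hMpos] at h1
      exact h1
    rw [hval, ← Real.sq_sqrt hMp]
    have := pi2_nonneg T
    gcongr

/-- Pietsch domination in finite dimension, with a finitely supported measure. -/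
theorem pi2_pietsch {X Y : Type*} [NormedAddCommGroup X] [NormedSpace ℝ X]
    [FiniteDimensional ℝ X] [NormedAddCommGroup Y] [NormedSpace ℝ Y] (T : X →L[ℝ] Y) :
    ∃ (ι : Type) (_ : Fintype ι) (w : ι → ℝ) (g : ι → (X →L[ℝ] ℝ)),
      (∀ i, 0 ≤ w i) ∧ ∑ i, w i = 1 ∧ (∀ i, ‖g i‖ ≤ 1) ∧
      ∀ v, ‖T v‖ ^ 2 ≤ pi2 T ^ 2 * ∑ i, w i * (g i v) ^ 2 := by
  classical
  set b := Module.finBasis ℝ X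
  let n := Fin (Module.finrank ℝ X)
  set P := pi2 T ^ 2
  let Ψ : (X →L[ℝ] ℝ) → (n × n → ℝ) := fun f p => f (b p.1) * f (b p.2)
  have hΨc : Continuous Ψ := by
    refine continuous_pi fun p => ?_
    simp only [Ψ]
    fun_prop
  have hΨq : ∀ (f : X →L[ℝ] ℝ) (x : X), qf (b.repr x) (Ψ f) = (f x) ^ 2 := by
    intro f x
    rw [← qf_eval b f x]
    refine (qf_tens (b.repr x) fun i => f (b i)).trans ?_
    congr 1
    exact Finset.sum_congr rfl fun i _ => mul_comm _ _
  let K := convexHull ℝ (Ψ '' Metric.closedBall 0 1)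
  have hK : IsCompact K :=
    isCompact_convexHull_fd ((isCompact_closedBall (0 : X →L[ℝ] ℝ) 1).image hΨc)
  have hmain : (K ∩ ⋂ v : X, {A | ‖T v‖ ^ 2 ≤ P * qf (b.repr v) A}).Nonempty := by
    refine hK.inter_iInter_nonempty _ (fun v => isClosed_le continuous_const (by fun_prop)) ?_
    intro u
    by_contra hne
    let L : (n × n → ℝ) →L[ℝ] (u → ℝ) :=
      ContinuousLinearMap.pi fun j => P • qf (b.repr (j : X))
    let N : u → ℝ := fun j => ‖T j‖ ^ 2
    have hdisj : Disjoint (L '' K) (Set.Ici N) := by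
      rw [Set.disjoint_left]
      rintro _ ⟨A, hA, rfl⟩ hN
      apply hne
      refine ⟨A, hA, ?_⟩
      simp only [Set.mem_iInter]
      intro v hv
      exact hN ⟨v, hv⟩
    obtain ⟨f, u0, v0, h1, h2, h3⟩ := geometric_hahn_banach_compact_closed
      ((convex_convexHull ℝ _).linear_image L.toLinearMap) (hK.image L.continuous)
      (convex_Ici N) isClosed_Ici hdisj
    let l : u → ℝ := fun j => f (Pi.single j 1)
    have hf : ∀ y : u → ℝ, f y = ∑ j, y j * l j := by
      intro y
      conv_lhs => rw [pi_eq_sum_univ' y]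
      simp [l]
    have hl : ∀ j, 0 ≤ l j := by
      intro j
      by_contra hneg
      push Not at hneg
      have hN := h3 N Set.self_mem_Ici
      have h4 := h3 (N + ((f N - v0) / (- l j)) • Pi.single j 1) (by
        have : 0 ≤ (f N - v0) / (- l j) := div_nonneg (by linarith) (by linarith)
        intro k
        have : 0 ≤ (((f N - v0) / (- l j)) • (Pi.single j 1 : u → ℝ)) k := by
          by_cases hk : k = j
          · subst hk; simpa using this
          · simp [hk]
        simpa using this)
      rw [map_add, map_smul, smul_eq_mul] at h4
      change v0 < f N + (f N - v0) / (- l j) * l j at h4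
      have : (f N - v0) / (- l j) * l j = -(f N - v0) := by
        field_simp [hneg.ne]
      linarith
    let x : u → X := fun j => Real.sqrt (l j) • (j : X)
    have hxf : ∀ g : X →L[ℝ] ℝ, ∑ j, (g (x j)) ^ 2 = ∑ j : u, (g j) ^ 2 * l j := by
      intro g
      refine Finset.sum_congr rfl fun j _ => ?_
      simp only [x, map_smul, smul_eq_mul, mul_pow, Real.sq_sqrt (hl j)]
      ring
    have hB : v0 < ∑ j, ‖T (x j)‖ ^ 2 := by
      refine (h3 N Set.self_mem_Ici).trans_eq ?_
      rw [hf]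
      refine Finset.sum_congr rfl fun j _ => ?_
      simp only [x, N, map_smul, norm_smul, mul_pow, Real.norm_eq_abs, sq_abs, Real.sq_sqrt (hl j)]
      ring
    obtain ⟨g0, hg0, hg0max⟩ := (isCompact_closedBall (0 : X →L[ℝ] ℝ) 1).exists_isMaxOn
      ⟨0, by simp⟩ (f := fun g : X →L[ℝ] ℝ => ∑ j, (g (x j)) ^ 2) (by fun_prop)
    have hb := pi2_bound T x (s := ∑ j, (g0 (x j)) ^ 2) (by positivity) (by
      intro g
      by_cases hg : g = 0
      · simp [hg]
      have hgn : 0 < ‖g‖ := norm_pos_iff.mpr hg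
      have h5 : ∑ j, ((‖g‖⁻¹ • g) (x j)) ^ 2 ≤ ∑ j, (g0 (x j)) ^ 2 := hg0max (by
        simp [norm_smul, hgn.ne'])
      simp only [smul_apply, smul_eq_mul, mul_pow, ← Finset.mul_sum] at h5
      rw [inv_pow, inv_mul_le_iff₀ (by positivity)] at h5
      linarith)
    have h6 := h1 (L (Ψ g0)) ⟨_, subset_convexHull _ _ ⟨g0, hg0, rfl⟩, rfl⟩
    rw [hf] at h6
    have h7 : ∑ j : u, L (Ψ g0) j * l j = (∑ j, (g0 (x j)) ^ 2) * P := by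
      rw [hxf, Finset.sum_mul]
      refine Finset.sum_congr rfl fun j _ => ?_
      have : L (Ψ g0) j = P * qf (b.repr (j : X)) (Ψ g0) := rfl
      rw [this, hΨq]
      ring
    rw [h7] at h6
    linarith
  obtain ⟨A, hA, hA'⟩ := hmain
  obtain ⟨ι, _, w, z, hw, hw1, hz, hp⟩ := mem_convexHull_iff_exists_fintype.1 hA
  choose g hg hgz using hz
  refine ⟨ι, inferInstance, w, g, hw, hw1, fun i => by simpa using hg i, fun v => ?_⟩
  have := Set.mem_iInter.1 hA' v
  simp only [Set.mem_ofPred_eq] at this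
  refine this.trans_eq ?_
  rw [← hp, map_sum]
  congr 1
  refine Finset.sum_congr rfl fun i _ => ?_
  rw [map_smul, ← hgz, hΨq, smul_eq_mul]

/-- Norm preserving extension. -/
theorem pi2_extension {X Y : Type*} [NormedAddCommGroup X] [NormedSpace ℝ X]
    [FiniteDimensional ℝ X] [NormedAddCommGroup Y] [NormedSpace ℝ Y]
    (E : Submodule ℝ X) (t : E →L[ℝ] Y) :
    ∃ T : X →L[ℝ] Y, (∀ v : E, T v = t v) ∧ pi2 T = pi2 t := by
  obtain ⟨ι, _, w, g, hw, hw1, hg, hdom⟩ := pi2_pietsch t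
  choose G hGg hGn using fun i => exists_extension_norm_eq E (g i)
  let H : X →L[ℝ] EuclideanSpace ℝ ι :=
    (EuclideanSpace.equiv ι ℝ).symm.toContinuousLinearMap.comp
      (ContinuousLinearMap.pi fun i => Real.sqrt (w i) • G i)
  have hH : ∀ x, ‖H x‖ ^ 2 = ∑ i, w i * (G i x) ^ 2 := by
    intro x
    rw [EuclideanSpace.norm_sq_eq]
    refine Finset.sum_congr rfl fun i _ => ?_
    simp [H, mul_pow, Real.sq_sqrt (hw i)]
  have hπ := pi2_nonneg t
  have htH : ∀ v : E, ‖t v‖ ≤ pi2 t * ‖H v‖ := by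
    intro v
    refine le_of_sq_le_sq ?_ (by positivity)
    rw [mul_pow, hH]
    simpa [hGg] using hdom v
  let HE : E →ₗ[ℝ] EuclideanSpace ℝ ι := H.toLinearMap.comp E.subtype
  obtain ⟨r, hr⟩ := HE.rangeRestrict.exists_rightInverse_of_surjective HE.range_rangeRestrict
  have hr' : ∀ y : LinearMap.range HE, H (r y) = y := by
    intro y
    exact congrArg Subtype.val (LinearMap.congr_fun hr y)
  let S : X →ₗ[ℝ] Y := t.toLinearMap.comp (r.comp
    ((LinearMap.range HE).orthogonalProjectionOnto.toLinearMap.comp H.toLinearMap))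
  have hS : ∀ x, S x = t (r ((LinearMap.range HE).orthogonalProjectionOnto (H x))) := fun _ => rfl
  let T : X →L[ℝ] Y := ⟨S, S.continuous_of_finiteDimensional⟩
  have hT : ∀ x, T x = t (r ((LinearMap.range HE).orthogonalProjectionOnto (H x))) := fun _ => rfl
  have hext : ∀ v : E, T v = t v := by
    intro v
    have hmem : H v ∈ LinearMap.range HE := ⟨v, rfl⟩
    have hp : (LinearMap.range HE).orthogonalProjectionOnto (H v) = ⟨H v, hmem⟩ :=
      Submodule.orthogonalProjectionOnto_mem_subspace_eq_self (⟨H v, hmem⟩ : LinearMap.range HE)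
    rw [hT, hp, ← sub_eq_zero, ← map_sub, ← norm_le_zero_iff]
    refine (htH _).trans_eq ?_
    rw [Submodule.coe_sub, map_sub, hr']
    simp
  refine ⟨T, hext, le_antisymm ?_ (pi2_restrict_le E T t hext)⟩
  refine pi2_le T hπ fun m x hx => ?_
  have hTx : ∀ v, ‖T v‖ ^ 2 ≤ pi2 t ^ 2 * ∑ i, w i * (G i v) ^ 2 := by
    intro v
    rw [← hH, ← mul_pow]
    gcongr
    rw [hT]
    refine (htH _).trans ?_
    rw [hr']
    gcongr
    exact (LinearMap.range HE).norm_orthogonalProjectionOnto_apply_le (H v)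
  calc ∑ i, ‖T (x i)‖ ^ 2 ≤ ∑ i, pi2 t ^ 2 * ∑ j, w j * (G j (x i)) ^ 2 :=
        Finset.sum_le_sum fun i _ => hTx _
    _ = pi2 t ^ 2 * ∑ j, w j * ∑ i, (G j (x i)) ^ 2 := by
        rw [← Finset.mul_sum, Finset.sum_comm]
        simp only [Finset.mul_sum]
    _ ≤ pi2 t ^ 2 * ∑ j, w j * 1 := by
        gcongr with j
        · exact hw j
        · refine (hx (G j)).trans ?_
          rw [hGn]
          exact pow_le_one₀ (norm_nonneg (g j)) (hg j)
    _ = _ := by simp [hw1]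

/-- For finite-dimensional `X`, `Y` with `Y` strictly convex, `Π₂(X,Y)` is strictly convex iff
every operator from a subspace of `X` to `Y` has a unique extension preserving the 2-summing
norm. -/
theorem pi2_strictly_convex_iff_unique_extension
    {X Y : Type*} [NormedAddCommGroup X] [NormedSpace ℝ X] [FiniteDimensional ℝ X]
    [NormedAddCommGroup Y] [NormedSpace ℝ Y] [FiniteDimensional ℝ Y]
    [StrictConvexSpace ℝ Y] :
    (∀ S T : X →L[ℝ] Y, pi2 S = pi2 T → pi2 S = pi2 (S + T) / 2 → S = T) ↔
    (∀ (E : Submodule ℝ X) (t : E →L[ℝ] Y),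
      ∃! T : X →L[ℝ] Y, (∀ v : E, T v = t v) ∧ pi2 T = pi2 t) := by

  constructor
  · intro hsc E t
    obtain ⟨T, hT, hTt⟩ := pi2_extension E t
    refine ⟨T, ⟨hT, hTt⟩, ?_⟩
    rintro S ⟨hS, hSt⟩
    refine hsc S T (hSt.trans hTt.symm) ?_
    have h0 := pi2_nonneg t
    have hle : pi2 (S + T) ≤ 2 * pi2 t := by
      refine pi2_le _ (by positivity) fun m x hx => ?_
      have h1 := pi2_bound_fin S x hx
      have h2 := pi2_bound_fin T x hx
      rw [hSt] at h1
      rw [hTt] at h2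
      have h3 : ∑ i, ‖(S + T) (x i)‖ ^ 2 ≤ ∑ i, (2 * ‖S (x i)‖ ^ 2 + 2 * ‖T (x i)‖ ^ 2) := by
        refine Finset.sum_le_sum fun i _ => ?_
        have h4 : ‖(S + T) (x i)‖ ≤ ‖S (x i)‖ + ‖T (x i)‖ := norm_add_le _ _
        have h5 := norm_nonneg ((S + T) (x i))
        nlinarith [sq_nonneg (‖S (x i)‖ - ‖T (x i)‖)]
      rw [Finset.sum_add_distrib, ← Finset.mul_sum, ← Finset.mul_sum] at h3
      nlinarith
    have hge : 2 * pi2 t ≤ pi2 (S + T) := by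
      have : pi2 t ≤ pi2 (S + T) / 2 := by
        refine pi2_le _ (div_nonneg (pi2_nonneg _) zero_le_two) fun m x hx => ?_
        have h1 := pi2_restrict_le E (S + T) ((2 : ℝ) • t) (by
          intro v
          simp [hS, hT, two_smul])
        have h2 := pi2_bound_fin ((2 : ℝ) • t) x hx
        have h3 := pi2_nonneg ((2 : ℝ) • t)
        simp only [smul_apply, norm_smul, mul_pow, ← Finset.mul_sum] at h2
        norm_num at h2
        nlinarith
      linarith
    linarith
  · intro huniq S T hST hmid
    obtain ⟨ι, _, x, hx, hatt⟩ := pi2_attained (S + T)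
    have hS := pi2_bound S x (s := 1) zero_le_one (by simpa using hx)
    have hT := pi2_bound T x (s := 1) zero_le_one (by simpa using hx)
    have hpt : ∀ i, ‖(S + T) (x i)‖ ^ 2 + (‖S (x i)‖ - ‖T (x i)‖) ^ 2 ≤
        2 * ‖S (x i)‖ ^ 2 + 2 * ‖T (x i)‖ ^ 2 := by
      intro i
      have h4 : ‖(S + T) (x i)‖ ≤ ‖S (x i)‖ + ‖T (x i)‖ := norm_add_le _ _
      have h5 := norm_nonneg ((S + T) (x i))
      nlinarith
    have h2p : pi2 (S + T) = 2 * pi2 S := by linarith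
    rw [h2p] at hatt
    rw [← hST] at hT
    have hsum0 : ∑ i, (2 * ‖S (x i)‖ ^ 2 + 2 * ‖T (x i)‖ ^ 2 - ‖(S + T) (x i)‖ ^ 2) ≤ 0 := by
      rw [Finset.sum_sub_distrib, Finset.sum_add_distrib, ← Finset.mul_sum, ← Finset.mul_sum]
      nlinarith
    have hnn : ∀ i, 0 ≤ 2 * ‖S (x i)‖ ^ 2 + 2 * ‖T (x i)‖ ^ 2 - ‖(S + T) (x i)‖ ^ 2 := by
      intro i
      nlinarith [hpt i, sq_nonneg (‖S (x i)‖ - ‖T (x i)‖)]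
    have heq0 := (Finset.sum_eq_zero_iff_of_nonneg (fun i _ => hnn i)).1
      (le_antisymm hsum0 (Finset.sum_nonneg fun i _ => hnn i))
    have hnorm : ∀ i, ‖S (x i)‖ = ‖T (x i)‖ := by
      intro i
      have h1 := heq0 i (Finset.mem_univ i)
      have h2 := hpt i
      have h3 : (‖S (x i)‖ - ‖T (x i)‖) ^ 2 = 0 :=
        le_antisymm (by linarith) (sq_nonneg _)
      exact sub_eq_zero.1 (pow_eq_zero_iff two_ne_zero |>.1 h3)
    have hSTx : ∀ i, S (x i) = T (x i) := by
      intro i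
      refine eq_of_norm_eq_of_norm_add_eq (hnorm i) ?_
      have h1 := heq0 i (Finset.mem_univ i)
      refine (sq_eq_sq₀ (norm_nonneg _) (by positivity)).1 ?_
      rw [hnorm i] at h1 ⊢
      rw [add_apply] at h1
      linarith
    have hSsum : ∑ i, ‖S (x i)‖ ^ 2 = pi2 S ^ 2 := by
      have : ∑ i, ‖(S + T) (x i)‖ ^ 2 = ∑ i, 4 * ‖S (x i)‖ ^ 2 := by
        refine Finset.sum_congr rfl fun i _ => ?_
        have h1 := heq0 i (Finset.mem_univ i)
        rw [← hnorm i] at h1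
        linarith
      rw [hatt, ← Finset.mul_sum] at this
      linarith
    let E : Submodule ℝ X := Submodule.span ℝ (Set.range x)
    have hxE : ∀ i, x i ∈ E := fun i => Submodule.subset_span ⟨i, rfl⟩
    let t : E →L[ℝ] Y := S.comp E.subtypeL
    have hTt : ∀ v : E, T v = t v := by
      rintro ⟨v, hv⟩
      have : Set.EqOn S.toLinearMap T.toLinearMap E :=
        LinearMap.eqOn_span' (by rintro _ ⟨i, rfl⟩; exact hSTx i)
      exact (this hv).symm
    have hpt' : pi2 S = pi2 t := by
      refine le_antisymm ?_ (pi2_restrict_le E S t fun v => rfl)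
      have h1 := pi2_bound t (fun i => (⟨x i, hxE i⟩ : E)) (s := 1) zero_le_one (by
        intro f
        obtain ⟨g, hg, hgn⟩ := exists_extension_norm_eq E f
        have := hx g
        rw [hgn] at this
        simpa [← hg] using this)
      have h2 : ∑ i, ‖t (⟨x i, hxE i⟩ : E)‖ ^ 2 = pi2 S ^ 2 := hSsum
      rw [h2, one_mul] at h1
      exact le_of_sq_le_sq h1 (pi2_nonneg t)
    exact (huniq E t).unique ⟨fun v => rfl, hpt'⟩ ⟨hTt, hST ▸ hpt'⟩
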